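/- Let α ∈ (0,1), t₀ > 0, and let p : [t₀,∞) → (0,∞) be a C³ function with p(t)·t^{α} → 1, p′(t)/(−α t^{−α−1}) → 1, p″(t)/(α(α+1) t^{−α−2}) → 1 and p‴(t)/(−α(α+1)(α+2) t^{−α−3}) → 1 as t → ∞ (i.e. p(t) ∼₃ t^{−α}). Define x : [t₀,∞) → ℝ by x(t) = p(t)·sin t, so x′(t) = p′(t)·sin t + p(t)·cos t. Then the planar curve Γ = {(x(t), x′(t)) : t ∈ [t₀,∞)} is a bounded subset of ℝ² whose lower and upper box dimensions both equal 2/(1+α); i.e. the phase dimension of x is dim_B Γ = 2/(1+α). -/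

import Mathlib

open Set Filter MeasureTheory Real

noncomputable section

/-- The Euclidean ε-neighborhood `A_ε = {y : dist(y, A) < ε}` of a set `A ⊆ ℝ²`
(with the Euclidean distance). -/
def euclNbhd (A : Set (ℝ × ℝ)) (ε : ℝ) : Set (ℝ × ℝ) :=
  {y | ∃ a ∈ A, Real.sqrt ((y.1 - a.1) ^ 2 + (y.2 - a.2) ^ 2) < ε}

/-- Lower `s`-dimensional Minkowski content of a set `A ⊆ ℝ²`:
`liminf_{ε→0⁺} vol₂(A_ε) / ε^{2-s}`. -/
def lowerMinkowskiContent (A : Set (ℝ × ℝ)) (s : ℝ) : ENNReal :=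
  Filter.liminf
    (fun ε : ℝ => MeasureTheory.volume (euclNbhd A ε) / ENNReal.ofReal (ε ^ (2 - s)))
    (nhdsWithin 0 (Set.Ioi 0))

/-- Upper `s`-dimensional Minkowski content of a set `A ⊆ ℝ²`:
`limsup_{ε→0⁺} vol₂(A_ε) / ε^{2-s}`. -/
def upperMinkowskiContent (A : Set (ℝ × ℝ)) (s : ℝ) : ENNReal :=
  Filter.limsup
    (fun ε : ℝ => MeasureTheory.volume (euclNbhd A ε) / ENNReal.ofReal (ε ^ (2 - s)))
    (nhdsWithin 0 (Set.Ioi 0))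

/-- Lower box dimension: `inf {s ≥ 0 : M_*^s(A) = 0}`. -/
def lowerBoxDim (A : Set (ℝ × ℝ)) : ℝ :=
  sInf {s : ℝ | 0 ≤ s ∧ lowerMinkowskiContent A s = 0}

/-- Upper box dimension: `inf {s ≥ 0 : M^{*s}(A) = 0}`. -/
def upperBoxDim (A : Set (ℝ × ℝ)) : ℝ :=
  sInf {s : ℝ | 0 ≤ s ∧ upperMinkowskiContent A s = 0}

end

theorem aux_boxdim (A : Set (ℝ × ℝ)) (d c C : ℝ) (hd : 0 < d) (hc : 0 < c)
    (hlow : ∀ᶠ ε in nhdsWithin (0:ℝ) (Set.Ioi 0),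
      ENNReal.ofReal (c * ε ^ (2 - d)) ≤ volume (euclNbhd A ε))
    (hup : ∀ᶠ ε in nhdsWithin (0:ℝ) (Set.Ioi 0),
      volume (euclNbhd A ε) ≤ ENNReal.ofReal (C * ε ^ (2 - d))) :
    lowerBoxDim A = d ∧ upperBoxDim A = d := by
  have hpos : ∀ᶠ ε in nhdsWithin (0:ℝ) (Set.Ioi 0), 0 < ε := self_mem_nhdsWithin
  have hlt1 : ∀ᶠ ε in nhdsWithin (0:ℝ) (Set.Ioi 0), ε < 1 :=
    nhdsWithin_le_nhds (Iio_mem_nhds one_pos)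
  have hU : ∀ s, d < s → upperMinkowskiContent A s = 0 := by
    intro s hs
    have h1 : Tendsto (fun ε : ℝ => ENNReal.ofReal (C * ε ^ (s - d)))
        (nhdsWithin 0 (Set.Ioi 0)) (nhds 0) := by
      have : Tendsto (fun ε : ℝ => C * ε ^ (s - d)) (nhdsWithin 0 (Set.Ioi 0)) (nhds 0) := by
        have h2 : Tendsto (fun ε : ℝ => C * ε ^ (s - d)) (nhds 0) (nhds (C * 0 ^ (s - d))) :=
          (Real.continuousAt_rpow_const 0 (s - d) (Or.inr (by linarith))).tendsto.const_mul C
        rw [Real.zero_rpow (by linarith : s - d ≠ 0) , mul_zero] at h2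
        exact h2.mono_left nhdsWithin_le_nhds
      simpa using ENNReal.tendsto_ofReal this
    refine Tendsto.limsup_eq (tendsto_of_tendsto_of_tendsto_of_le_of_le' tendsto_const_nhds h1
      (Eventually.of_forall fun _ => zero_le) ?_)
    filter_upwards [hup, hpos] with ε h1 h2
    have h3 : 0 < ε ^ (2 - s) := Real.rpow_pos_of_pos h2 _
    calc _ ≤ ENNReal.ofReal (C * ε ^ (2 - d)) / ENNReal.ofReal (ε ^ (2 - s)) := by gcongr
      _ = ENNReal.ofReal (C * ε ^ (2 - d) / ε ^ (2 - s)) := (ENNReal.ofReal_div_of_pos h3).symm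
      _ = _ := by
        congr 1
        rw [mul_div_assoc, ← Real.rpow_sub h2]
        congr 2; ring
  have hL : ∀ s, s < d → lowerMinkowskiContent A s ≠ 0 := by
    intro s hs h0
    have : ENNReal.ofReal c ≤ lowerMinkowskiContent A s := by
      refine le_liminf_of_le (by isBoundedDefault) ?_
      filter_upwards [hlow, hpos, hlt1] with ε h1 h2 h4
      have h3 : 0 < ε ^ (2 - s) := Real.rpow_pos_of_pos h2 _
      calc ENNReal.ofReal c ≤ ENNReal.ofReal (c * ε ^ (2 - d) / ε ^ (2 - s)) := by
            apply ENNReal.ofReal_le_ofReal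
            rw [le_div_iff₀ h3]
            have := Real.rpow_le_rpow_of_exponent_ge h2 h4.le (by linarith : 2 - d ≤ 2 - s)
            gcongr
        _ = ENNReal.ofReal (c * ε ^ (2 - d)) / ENNReal.ofReal (ε ^ (2 - s)) :=
            ENNReal.ofReal_div_of_pos h3
        _ ≤ _ := by gcongr
    rw [h0] at this
    simp at this
    linarith
  have hLU : ∀ s, lowerMinkowskiContent A s ≤ upperMinkowskiContent A s :=
    fun s => liminf_le_limsup
  have key : ∀ S : Set ℝ, (∀ s, d < s → s ∈ S) → (∀ s ∈ S, d ≤ s) → sInf S = d := by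
    intro S h1 h2
    apply le_antisymm
    · exact le_of_forall_gt fun s hs => lt_of_le_of_lt
        (csInf_le ⟨d, fun x hx => h2 x hx⟩ (h1 ((d+s)/2) (by linarith))) (by linarith)
    · exact le_csInf ⟨d+1, h1 _ (by linarith)⟩ h2
  constructor
  · apply key
    · exact fun s hs => ⟨by linarith, le_antisymm ((hLU s).trans (hU s hs).le) zero_le⟩
    · rintro s ⟨-, h⟩
      by_contra! h'
      exact hL s h' h
  · apply key
    · exact fun s hs => ⟨by linarith, hU s hs⟩
    · rintro s ⟨-, h⟩
      by_contra! h'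
      exact hL s h' (le_antisymm ((hLU s).trans h.le) zero_le)

theorem aux_vol_ball (P : ℝ × ℝ) (r : ℝ) (hr : 0 ≤ r) :
    volume (Metric.ball P r) = ENNReal.ofReal (4 * r ^ 2) := by
  rw [← ball_prod_same, Measure.volume_eq_prod, Measure.prod_prod, Real.volume_ball,
    Real.volume_ball, ← ENNReal.ofReal_mul (by positivity)]
  congr 1; ring

theorem aux_upper (α t₀ K M : ℝ) (hα0 : 0 < α) (hα1 : α < 1) (ht₀ : 0 < t₀) (hK : 0 ≤ K)
    (hM : 0 ≤ M) (X Y : ℝ → ℝ) (P : ℝ × ℝ) (A : Set (ℝ × ℝ))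
    (hX : ∀ a b, t₀ ≤ a → a ≤ b → |X b - X a| ≤ K * (b ^ (1 - α) - a ^ (1 - α)))
    (hY : ∀ a b, t₀ ≤ a → a ≤ b → |Y b - Y a| ≤ K * (b ^ (1 - α) - a ^ (1 - α)))
    (hXM : ∀ t, t₀ ≤ t → |X t| ≤ M * t ^ (-α))
    (hYM : ∀ t, t₀ ≤ t → |Y t| ≤ M * t ^ (-α))
    (hA : ∀ a ∈ A, a = P ∨ ∃ t, t₀ ≤ t ∧ a = (X t, Y t)) :
    ∀ᶠ ε in nhdsWithin (0:ℝ) (Set.Ioi 0),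
      volume (euclNbhd A ε) ≤
        ENNReal.ofReal ((4 + 4 * (M + 1) ^ 2 + 8 * (K + 1) ^ 2) * ε ^ (2 - 2 / (1 + α))) := by
  have hpos : ∀ᶠ ε in nhdsWithin (0:ℝ) (Set.Ioi 0), 0 < ε := self_mem_nhdsWithin
  have hlt1 : ∀ᶠ ε in nhdsWithin (0:ℝ) (Set.Ioi 0), ε < 1 :=
    nhdsWithin_le_nhds (Iio_mem_nhds one_pos)
  filter_upwards [hpos, hlt1] with ε he he1
  set T : ℝ := ε ^ (-(1 / (1 + α))) with hT
  have hTpos : 0 < T := Real.rpow_pos_of_pos he _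
  set N : ℕ := ⌊T ^ (1 - α) / ε⌋₊ with hN
  set u : ℕ → ℝ := fun k => (t₀ ^ (1 - α) + k * ε) ^ (1 / (1 - α)) with hu
  have h1α : 0 < 1 - α := by linarith
  have h1pα : 0 < 1 + α := by linarith
  have hsub : euclNbhd A ε ⊆ Metric.ball P ε ∪ Metric.ball 0 (M * T ^ (-α) + ε) ∪
      ⋃ k ∈ Finset.range (N + 1), Metric.ball (X (u k), Y (u k)) ((K + 1) * ε) := by
    rintro y ⟨a, ha, hya⟩
    have hy1 : |y.1 - a.1| < ε := lt_of_le_of_lt (Real.abs_le_sqrt (by nlinarith [sq_nonneg (y.2 - a.2)])) hya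
    have hy2 : |y.2 - a.2| < ε := lt_of_le_of_lt (Real.abs_le_sqrt (by nlinarith [sq_nonneg (y.1 - a.1)])) hya
    rcases hA a ha with rfl | ⟨t, ht, rfl⟩
    · left; left
      rw [Metric.mem_ball, Prod.dist_eq, max_lt_iff, Real.dist_eq, Real.dist_eq]
      exact ⟨hy1, hy2⟩
    · have htpos : 0 < t := by linarith
      simp only at hy1 hy2
      rcases le_or_gt T t with hTt | hTt
      · left; right
        have h3 : t ^ (-α) ≤ T ^ (-α) :=
          Real.rpow_le_rpow_of_nonpos hTpos hTt (by linarith)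
        have h4 : M * t ^ (-α) ≤ M * T ^ (-α) := by gcongr
        have hx := hXM t ht
        have hy := hYM t ht
        rw [Metric.mem_ball, Prod.dist_eq, max_lt_iff, Real.dist_eq, Real.dist_eq]
        simp only [Prod.fst_zero, Prod.snd_zero, sub_zero]
        constructor
        · have := abs_sub_abs_le_abs_sub y.1 (X t)
          linarith
        · have := abs_sub_abs_le_abs_sub y.2 (Y t)
          linarith
      · right
        have hmono : t₀ ^ (1 - α) ≤ t ^ (1 - α) := Real.rpow_le_rpow ht₀.le ht h1α.le
        have hmono2 : t ^ (1 - α) ≤ T ^ (1 - α) := Real.rpow_le_rpow htpos.le hTt.le h1α.le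
        have ht0p : 0 < t₀ ^ (1 - α) := Real.rpow_pos_of_pos ht₀ _
        set k : ℕ := ⌊(t ^ (1 - α) - t₀ ^ (1 - α)) / ε⌋₊ with hk
        have hq : 0 ≤ (t ^ (1 - α) - t₀ ^ (1 - α)) / ε := div_nonneg (by linarith) he.le
        have hk1 : (k : ℝ) * ε ≤ t ^ (1 - α) - t₀ ^ (1 - α) := by
          rw [← le_div_iff₀ he]; exact Nat.floor_le hq
        have hk2 : t ^ (1 - α) - t₀ ^ (1 - α) < (k + 1) * ε := by
          rw [← div_lt_iff₀ he]; exact Nat.lt_floor_add_one _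
        have hkN : k ≤ N := by
          apply Nat.floor_le_floor
          gcongr
          linarith
        have hke : 0 ≤ (k : ℝ) * ε := by positivity
        have huk : (u k) ^ (1 - α) = t₀ ^ (1 - α) + k * ε := by
          simp only [hu]
          rw [← Real.rpow_mul (by linarith), one_div_mul_cancel h1α.ne', Real.rpow_one]
        have hukpos : 0 ≤ u k := Real.rpow_nonneg (by linarith) _
        have huk1 : t₀ ≤ u k := by
          rw [← Real.rpow_le_rpow_iff ht₀.le hukpos h1α, huk]; linarith
        have huk2 : u k ≤ t := by
          rw [← Real.rpow_le_rpow_iff hukpos htpos.le h1α, huk]; linarith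
        have hx := hX _ _ huk1 huk2
        have hy := hY _ _ huk1 huk2
        have hle : K * (t ^ (1 - α) - (u k) ^ (1 - α)) ≤ K * ε := by
          apply mul_le_mul_of_nonneg_left _ hK
          rw [huk]; linarith
        simp only [Set.mem_iUnion]
        refine ⟨k, Finset.mem_range.2 (by omega), ?_⟩
        rw [Metric.mem_ball, Prod.dist_eq, max_lt_iff, Real.dist_eq, Real.dist_eq]
        constructor
        · have := abs_sub_le y.1 (X t) (X (u k))
          simp only
          linarith
        · have := abs_sub_le y.2 (Y t) (Y (u k))
          simp only
          linarith
  have hTα : T ^ (-α) = ε ^ (α / (1 + α)) := by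
    rw [hT, ← Real.rpow_mul he.le]; congr 1; field_simp
  have hT1α : T ^ (1 - α) * ε = ε ^ (2 - 2 / (1 + α)) := by
    rw [hT, ← Real.rpow_mul he.le]
    nth_rewrite 2 [← Real.rpow_one ε]
    rw [← Real.rpow_add he]; congr 1; field_simp; ring
  set E : ℝ := ε ^ (2 - 2 / (1 + α)) with hE
  have hsq : (ε ^ (α / (1 + α))) ^ 2 = E := by
    rw [← Real.rpow_natCast, ← Real.rpow_mul he.le, hE]; congr 1; push_cast; field_simp; ring
  have hle1 : ε ≤ ε ^ (α / (1 + α)) := by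
    nth_rewrite 1 [← Real.rpow_one ε]
    apply Real.rpow_le_rpow_of_exponent_ge he he1.le
    rw [div_le_one h1pα]; linarith
  have hle2 : ε ^ 2 ≤ E := by rw [← hsq]; gcongr
  have hNle : (N : ℝ) ≤ T ^ (1 - α) / ε := Nat.floor_le (by positivity)
  have hNe : (N : ℝ) * ε ^ 2 ≤ E := by
    rw [← hT1α]
    have := mul_le_mul_of_nonneg_right hNle (sq_nonneg ε)
    calc _ ≤ _ := this
      _ = _ := by field_simp
  have hTn : 0 ≤ T ^ (-α) := by positivity
  calc volume (euclNbhd A ε) ≤ _ := measure_mono hsub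
    _ ≤ volume (Metric.ball P ε) + volume (Metric.ball (0 : ℝ × ℝ) (M * T ^ (-α) + ε)) +
        ∑ k ∈ Finset.range (N + 1), volume (Metric.ball (X (u k), Y (u k)) ((K + 1) * ε)) := by
      refine (measure_union_le _ _).trans (add_le_add (measure_union_le _ _) ?_)
      exact measure_biUnion_finset_le _ _
    _ = ENNReal.ofReal (4 * ε ^ 2) + ENNReal.ofReal (4 * (M * T ^ (-α) + ε) ^ 2) +
        ENNReal.ofReal ((N + 1) * (4 * ((K + 1) * ε) ^ 2)) := by
      rw [aux_vol_ball _ _ he.le, aux_vol_ball _ _ (by positivity),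
        Finset.sum_congr rfl fun k _ => aux_vol_ball (X (u k), Y (u k)) ((K + 1) * ε) (by positivity)]
      rw [Finset.sum_const, Finset.card_range, nsmul_eq_mul,
        ENNReal.ofReal_mul (by positivity : (0:ℝ) ≤ (N:ℝ) + 1)]
      congr 2
      rw [← Nat.cast_succ, ENNReal.ofReal_natCast]
    _ = ENNReal.ofReal (4 * ε ^ 2 + 4 * (M * T ^ (-α) + ε) ^ 2 +
        (N + 1) * (4 * ((K + 1) * ε) ^ 2)) := by
      rw [ENNReal.ofReal_add (by positivity) (by positivity),
        ENNReal.ofReal_add (by positivity) (by positivity)]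
    _ ≤ _ := by
      apply ENNReal.ofReal_le_ofReal
      have h5 : (M * T ^ (-α) + ε) ^ 2 ≤ (M + 1) ^ 2 * E := by
        rw [← hsq, ← mul_pow]
        rw [hTα]
        apply pow_le_pow_left₀ (by positivity)
        linarith
      have h6 : (N + 1) * (4 * ((K + 1) * ε) ^ 2) ≤ 8 * (K + 1) ^ 2 * E := by
        calc (N + 1) * (4 * ((K + 1) * ε) ^ 2) = 4 * (K + 1) ^ 2 * (N * ε ^ 2 + ε ^ 2) := by ring
          _ ≤ 4 * (K + 1) ^ 2 * (E + E) := by gcongr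
          _ = _ := by ring
      linarith

set_option maxHeartbeats 1000000 in
theorem aux_lower (α T₁ : ℝ) (hα0 : 0 < α) (hα1 : α < 1) (hT₁ : 0 < T₁)
    (p : ℝ → ℝ) (A : Set (ℝ × ℝ))
    (hcont : ContinuousOn p (Set.Ici T₁))
    (hdiff : ∀ s ≥ T₁, DifferentiableAt ℝ p s)
    (hp0 : ∀ s ≥ T₁, 1 / 2 * s ^ (-α) ≤ p s)
    (hp1 : ∀ s ≥ T₁, |deriv p s| ≤ 2 * s ^ (-α - 1))
    (hlim : Tendsto p atTop (nhds 0))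
    (hA : ∀ s ≥ T₁, (p s * Real.sin s, deriv p s * Real.sin s + p s * Real.cos s) ∈ A) :
    ∀ᶠ ε in nhdsWithin (0:ℝ) (Set.Ioi 0),
      ENNReal.ofReal ((1 / 16 * (1 / 30) ^ (2 - 2 / (1 + α))) * ε ^ (2 - 2 / (1 + α)))
        ≤ volume (euclNbhd A ε) := by
  have h1pα : 0 < 1 + α := by linarith
  have hpos : ∀ᶠ ε in nhdsWithin (0:ℝ) (Set.Ioi 0), 0 < ε := self_mem_nhdsWithin
  have hlt1 : ∀ᶠ ε in nhdsWithin (0:ℝ) (Set.Ioi 0), ε < 30 * T₁ ^ (-(1 + α)) :=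
    nhdsWithin_le_nhds (Iio_mem_nhds (by positivity))
  filter_upwards [hpos, hlt1] with ε he he1
  set δ : ℝ := 1 / 30 * ε with hδ
  have hδ0 : 0 < δ := by positivity
  set T : ℝ := δ ^ (-(1 / (1 + α))) with hT
  have hTpos : 0 < T := Real.rpow_pos_of_pos hδ0 _
  have hTδ : T ^ (-α - 1) = δ := by
    rw [hT, ← Real.rpow_mul hδ0.le]
    have : -(1 / (1 + α)) * (-α - 1) = 1 := by field_simp; ring
    rw [this, Real.rpow_one]
  have hT₁T : T₁ ≤ T := by
    by_contra! h
    have := Real.rpow_le_rpow_of_nonpos hTpos h.le (by linarith : -α - 1 ≤ 0)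
    rw [hTδ, show -α - 1 = -(1 + α) by ring] at this
    linarith
  have hpT := hp0 T hT₁T
  have hpTpos : 0 < p T := lt_of_lt_of_le (by positivity) hpT
  have hsub : Set.Ioo 0 (p T / 2) ×ˢ Set.Ioo 0 (p T / 2) ⊆ euclNbhd A ε := by
    rintro ⟨a, b⟩ ⟨⟨ha0, ha1⟩, ⟨hb0, hb1⟩⟩
    simp only at ha0 ha1 hb0 hb1
    set z : ℂ := ⟨b, a⟩ with hz
    set r : ℝ := ‖z‖ with hr
    set θ : ℝ := z.arg with hθ
    have hcos : r * Real.cos θ = b := Complex.norm_mul_cos_arg z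
    have hsin : r * Real.sin θ = a := Complex.norm_mul_sin_arg z
    have hr0 : 0 < r := by
      rw [hr, norm_pos_iff]; intro h
      have := congrArg Complex.re h
      simp [hz] at this; linarith
    have hr1 : r ≤ p T := by
      have := Complex.norm_le_abs_re_add_abs_im z
      simp only [hz] at this
      rw [abs_of_pos ha0, abs_of_pos hb0] at this
      linarith
    obtain ⟨s, hs, hps⟩ : ∃ s ≥ T, p s = r := by
      obtain ⟨B, hB1, hB2⟩ := ((hlim.eventually (gt_mem_nhds hr0)).and (eventually_ge_atTop T)).exists
      obtain ⟨s, hs, h⟩ := intermediate_value_Icc' hB2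
        (hcont.mono fun x hx => hT₁T.trans hx.1) ⟨hB1.le, hr1⟩
      exact ⟨s, hs.1, h⟩
    set t := toIcoMod Real.two_pi_pos s θ with ht
    have htm := toIcoMod_mem_Ico Real.two_pi_pos s θ
    have htθ : t = θ - (toIcoDiv Real.two_pi_pos s θ : ℤ) * (2 * Real.pi) := by
      rw [ht, toIcoMod, zsmul_eq_mul]
    have hts : Real.sin t = Real.sin θ := by rw [htθ, Real.sin_sub_int_mul_two_pi]
    have htc : Real.cos t = Real.cos θ := by rw [htθ, Real.cos_sub_int_mul_two_pi]
    have hbd : ∀ w ≥ T, |deriv p w| ≤ 2 * δ := by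
      intro w hw
      refine (hp1 w (hT₁T.trans hw)).trans ?_
      have := Real.rpow_le_rpow_of_nonpos hTpos hw (by linarith : -α - 1 ≤ 0)
      rw [hTδ] at this
      linarith
    have htT : T ≤ t := hs.trans htm.1
    have hmv : |p t - p s| ≤ 2 * δ * |t - s| := by
      have := Convex.norm_image_sub_le_of_norm_deriv_le (f := p) (s := Set.Ici T) (C := 2 * δ)
        (x := s) (y := t)
        (fun w hw => hdiff w (hT₁T.trans hw)) (fun w hw => hbd w hw) (convex_Ici T) hs htT
      simpa [Real.norm_eq_abs] using this
    have hts' : |t - s| ≤ 2 * Real.pi := by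
      rw [abs_of_nonneg (by linarith [htm.1])]
      linarith [htm.2]
    have hpi := Real.pi_lt_d2
    have hmv2 : |p t - r| ≤ 13 * δ := by
      rw [← hps]
      refine hmv.trans ?_
      nlinarith
    refine ⟨_, hA t (hT₁T.trans htT), ?_⟩
    simp only
    rw [hts, htc, ← hsin, ← hcos]
    have hS := Real.abs_sin_le_one θ
    have hC := Real.abs_cos_le_one θ
    have e1 : |r * Real.sin θ - p t * Real.sin θ| ≤ 13 * δ := by
      rw [← sub_mul, abs_mul, abs_sub_comm]
      nlinarith [abs_nonneg (p t - r)]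
    have e2 : |r * Real.cos θ - (deriv p t * Real.sin θ + p t * Real.cos θ)| ≤ 15 * δ := by
      have h1 : |(p t - r) * Real.cos θ| ≤ 13 * δ := by
        rw [abs_mul]; nlinarith [abs_nonneg (p t - r)]
      have h2 : |deriv p t * Real.sin θ| ≤ 2 * δ := by
        rw [abs_mul]; nlinarith [abs_nonneg (deriv p t), hbd t htT]
      rw [abs_le] at *
      constructor <;> linarith
    rw [Real.sqrt_lt' he]
    have e1' := sq_le_sq' (neg_le_of_abs_le e1) (le_of_abs_le e1)
    have e2' := sq_le_sq' (neg_le_of_abs_le e2) (le_of_abs_le e2)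
    have : ε = 30 * δ := by rw [hδ]; ring
    rw [this]
    nlinarith [mul_pos hδ0 hδ0]
  refine le_trans ?_ (measure_mono hsub)
  rw [Measure.volume_eq_prod, Measure.prod_prod, Real.volume_Ioo, sub_zero,
    ← ENNReal.ofReal_mul (by positivity)]
  apply ENNReal.ofReal_le_ofReal
  have h7 : (T ^ (-α)) ^ 2 = (1 / 30) ^ (2 - 2 / (1 + α)) * ε ^ (2 - 2 / (1 + α)) := by
    rw [← Real.mul_rpow (by norm_num) he.le, ← hδ, hT, ← Real.rpow_natCast,
      ← Real.rpow_mul hδ0.le, ← Real.rpow_mul hδ0.le]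
    have e : -(1 / (1 + α)) * -α * ((2 : ℕ) : ℝ) = 2 - 2 / (1 + α) := by
      push_cast; field_simp; ring
    rw [e]
  have h8 : 0 < T ^ (-α) := by positivity
  rw [mul_assoc, ← h7]
  nlinarith

theorem aux_bound (α t₀ B : ℝ) (ht₀ : 0 < t₀) (f : ℝ → ℝ)
    (hf : ContinuousOn f (Set.Ici t₀)) (hB : ∀ᶠ t in atTop, |f t| ≤ B * t ^ (-α)) :
    ∃ M, 0 ≤ M ∧ ∀ t, t₀ ≤ t → |f t| ≤ M * t ^ (-α) := by
  obtain ⟨T, hT⟩ := eventually_atTop.1 hB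
  have hc : ContinuousOn (fun t => f t * t ^ α) (Set.Icc t₀ T) := by
    apply (hf.mono Set.Icc_subset_Ici_self).mul
    intro t ht
    exact (Real.continuousAt_rpow_const t α
      (Or.inl (by linarith [ht.1] : t ≠ 0))).continuousWithinAt
  obtain ⟨C, hC⟩ := isCompact_Icc.exists_bound_of_continuousOn hc
  refine ⟨max 0 (max B C), le_max_left _ _, fun t ht => ?_⟩
  have htp : 0 < t := by linarith
  have h1 : 0 < t ^ (-α) := Real.rpow_pos_of_pos htp _
  rcases le_total T t with h | h
  · refine (hT t h).trans ?_
    gcongr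
    exact (le_max_left _ _).trans (le_max_right _ _)
  · have h2 := hC t ⟨ht, h⟩
    have h3 : 0 < t ^ α := Real.rpow_pos_of_pos htp _
    rw [Real.norm_eq_abs, abs_mul, abs_of_pos h3] at h2
    have h4 : t ^ α * t ^ (-α) = 1 := by rw [← Real.rpow_add htp]; simp
    calc |f t| = |f t| * t ^ α * t ^ (-α) := by rw [mul_assoc, h4, mul_one]
      _ ≤ C * t ^ (-α) := by gcongr
      _ ≤ _ := by
        gcongr
        exact (le_max_right _ _).trans (le_max_right _ _)

theorem aux_lip (α t₀ M : ℝ) (hα1 : α < 1) (ht₀ : 0 < t₀) (f f' : ℝ → ℝ)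
    (hf : ContinuousOn f (Set.Ici t₀)) (hd : ∀ t, t₀ < t → HasDerivAt f (f' t) t)
    (hb : ∀ t, t₀ < t → |f' t| ≤ M * t ^ (-α)) :
    ∀ a b, t₀ ≤ a → a ≤ b → |f b - f a| ≤ M / (1 - α) * (b ^ (1 - α) - a ^ (1 - α)) := by
  have h1α : 0 < 1 - α := by linarith
  have hgc : ContinuousOn (fun t : ℝ => M / (1 - α) * t ^ (1 - α)) (Set.Ici t₀) := by
    intro t ht
    exact ((Real.continuousAt_rpow_const t (1 - α)
      (Or.inr h1α.le)).const_mul _).continuousWithinAt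
  have hgd : ∀ t, t₀ < t → HasDerivAt (fun t : ℝ => M / (1 - α) * t ^ (1 - α))
      (M * t ^ (-α)) t := by
    intro t ht
    have h := (Real.hasDerivAt_rpow_const (x := t) (p := 1 - α)
      (Or.inl (by linarith))).const_mul (M / (1 - α))
    have e : M / (1 - α) * ((1 - α) * t ^ (1 - α - 1)) = M * t ^ (-α) := by
      rw [show 1 - α - 1 = -α by ring]
      field_simp
    rw [e] at h
    exact h
  have m1 : MonotoneOn (fun t : ℝ => M / (1 - α) * t ^ (1 - α) + f t) (Set.Ici t₀) := by
    apply monotoneOn_of_hasDerivWithinAt_nonneg (convex_Ici t₀) (hgc.add hf)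
      (f' := fun t => M * t ^ (-α) + f' t)
    · intro t ht
      rw [interior_Ici] at ht
      exact ((hgd t ht).add (hd t ht)).hasDerivWithinAt
    · intro t ht
      rw [interior_Ici] at ht
      linarith [neg_le_of_abs_le (hb t ht)]
  have m2 : MonotoneOn (fun t : ℝ => M / (1 - α) * t ^ (1 - α) - f t) (Set.Ici t₀) := by
    apply monotoneOn_of_hasDerivWithinAt_nonneg (convex_Ici t₀) (hgc.sub hf)
      (f' := fun t => M * t ^ (-α) - f' t)
    · intro t ht
      rw [interior_Ici] at ht
      exact ((hgd t ht).sub (hd t ht)).hasDerivWithinAt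
    · intro t ht
      rw [interior_Ici] at ht
      linarith [le_of_abs_le (hb t ht)]
  intro a b ha hab
  have h1 := m1 ha (ha.trans hab : t₀ ≤ b) hab
  have h2 := m2 ha (ha.trans hab : t₀ ≤ b) hab
  simp only at h1 h2
  rw [abs_le]
  constructor <;> linarith


/-- Chirp–spiral comparison, part (i) of Theorem `s-c-p`:
the phase dimension of `x(t) = p(t) sin t` with `p(t) ∼₃ t^{-α}`, `α ∈ (0,1)`,
equals `2/(1+α)`. -/
theorem phase_dimension_of_chirp
    (α t₀ : ℝ) (hα : α ∈ Set.Ioo (0 : ℝ) 1) (ht₀ : 0 < t₀)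
    (p : ℝ → ℝ)
    (hp_pos : ∀ s ≥ t₀, 0 < p s)
    (hp_smooth : ContDiffOn ℝ 3 p (Set.Ici t₀))
    -- p(t) ∼₃ t^{-α} as t → ∞
    (hp0 : Filter.Tendsto (fun s => p s * s ^ α) Filter.atTop (nhds 1))
    (hp1 : Filter.Tendsto (fun s => deriv p s / (-α * s ^ (-α - 1)))
      Filter.atTop (nhds 1))
    (hp2 : Filter.Tendsto (fun s => deriv (deriv p) s / (α * (α + 1) * s ^ (-α - 2)))
      Filter.atTop (nhds 1))
    (hp3 : Filter.Tendsto
      (fun s => deriv (deriv (deriv p)) s / (-(α * (α + 1) * (α + 2)) * s ^ (-α - 3)))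
      Filter.atTop (nhds 1))
    (x x' : ℝ → ℝ)
    (hx : ∀ s, x s = p s * Real.sin s)
    (hx' : ∀ s, x' s = deriv p s * Real.sin s + p s * Real.cos s)
    (Γ : Set (ℝ × ℝ))
    (hΓ : Γ = {P : ℝ × ℝ | ∃ s ≥ t₀, P = (x s, x' s)}) :
    Bornology.IsBounded Γ ∧
    lowerBoxDim Γ = 2 / (1 + α) ∧ upperBoxDim Γ = 2 / (1 + α) := by
  obtain ⟨hα0, hα1⟩ := hα
  have h1pα : 0 < 1 + α := by linarith
  set S : Set ℝ := Set.Ici t₀ with hS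
  have hud : UniqueDiffOn ℝ S := uniqueDiffOn_Ici t₀
  set q : ℝ → ℝ := derivWithin p S with hq
  set r : ℝ → ℝ := derivWithin q S with hr
  have hq_smooth : ContDiffOn ℝ 2 q S := hp_smooth.derivWithin hud (by norm_num)
  have hr_smooth : ContDiffOn ℝ 1 r S := hq_smooth.derivWithin hud (by norm_num)
  have hpc : ContinuousOn p S := hp_smooth.continuousOn
  have hqc : ContinuousOn q S := hq_smooth.continuousOn
  have hrc : ContinuousOn r S := hr_smooth.continuousOn
  have hpd : ∀ t, t₀ < t → HasDerivAt p (q t) t := fun t ht =>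
    ((hp_smooth.differentiableOn (by norm_num)) t ht.le).hasDerivWithinAt.hasDerivAt
      (Ici_mem_nhds ht)
  have hqd : ∀ t, t₀ < t → HasDerivAt q (r t) t := fun t ht =>
    ((hq_smooth.differentiableOn (by norm_num)) t ht.le).hasDerivWithinAt.hasDerivAt
      (Ici_mem_nhds ht)
  have hdp : ∀ t, t₀ < t → deriv p t = q t := fun t ht => (hpd t ht).deriv
  have hddp : ∀ t, t₀ < t → deriv (deriv p) t = r t := by
    intro t ht
    have : deriv p =ᶠ[nhds t] q := by
      filter_upwards [Ioi_mem_nhds ht] with w hw using hdp w hw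
    rw [this.deriv_eq, (hqd t ht).deriv]
  -- eventual bounds
  have ev0 : ∀ᶠ s in atTop, 1 / 2 * s ^ (-α) ≤ p s ∧ p s ≤ 2 * s ^ (-α) := by
    filter_upwards [hp0.eventually (lt_mem_nhds (by norm_num : (1/2:ℝ) < 1)),
      hp0.eventually (gt_mem_nhds (by norm_num : (1:ℝ) < 2)), eventually_gt_atTop 0] with s h1 h2 h3
    have h4 : 0 < s ^ α := Real.rpow_pos_of_pos h3 _
    rw [Real.rpow_neg h3.le]
    constructor
    · rw [← div_eq_mul_inv, div_le_iff₀ h4]; exact h1.le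
    · rw [← div_eq_mul_inv, le_div_iff₀ h4]; exact h2.le
  have aux : ∀ (f : ℝ → ℝ) (k e : ℝ), k ≠ 0 →
      Tendsto (fun s => f s / (k * s ^ e)) atTop (nhds 1) →
      ∀ᶠ s in atTop, |f s| ≤ 2 * |k| * s ^ e := by
    intro f k e hk h
    filter_upwards [h.eventually (lt_mem_nhds (by norm_num : (-2:ℝ) < 1)),
      h.eventually (gt_mem_nhds (by norm_num : (1:ℝ) < 2)), eventually_gt_atTop 0] with s h1 h2 h3
    have h4 : 0 < s ^ e := Real.rpow_pos_of_pos h3 _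
    have h5 : |f s / (k * s ^ e)| ≤ 2 := abs_le.2 ⟨h1.le, h2.le⟩
    rw [abs_div, abs_mul, abs_of_pos h4, div_le_iff₀ (by positivity)] at h5
    linarith
  have ev1 : ∀ᶠ s in atTop, |deriv p s| ≤ 2 * s ^ (-α - 1) := by
    filter_upwards [aux _ _ _ (by linarith : -α ≠ 0) hp1, eventually_gt_atTop 0] with s h1 h3
    refine h1.trans ?_
    have h4 : 0 < s ^ (-α - 1) := Real.rpow_pos_of_pos h3 _
    rw [abs_neg, abs_of_pos hα0]
    gcongr
    linarith
  have ev2 : ∀ᶠ s in atTop, |deriv (deriv p) s| ≤ 4 * s ^ (-α - 2) := by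
    filter_upwards [aux _ _ _ (by positivity : α * (α + 1) ≠ 0) hp2,
      eventually_gt_atTop 0] with s h1 h3
    refine h1.trans ?_
    have h4 : 0 < s ^ (-α - 2) := Real.rpow_pos_of_pos h3 _
    rw [abs_of_pos (by positivity)]
    gcongr
    nlinarith
  obtain ⟨M0, hM0, hb0⟩ := aux_bound α t₀ 2 ht₀ p hpc (by
    filter_upwards [ev0, eventually_ge_atTop t₀] with s h1 h2
    rw [abs_of_pos (hp_pos s h2)]; exact h1.2)
  obtain ⟨M1, hM1, hb1⟩ := aux_bound α t₀ 2 ht₀ q hqc (by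
    filter_upwards [ev1, eventually_gt_atTop t₀, eventually_ge_atTop 1] with s h1 h2 h3
    rw [← hdp s h2]
    refine h1.trans ?_
    have := Real.rpow_le_rpow_of_exponent_le h3 (by linarith : -α - 1 ≤ -α)
    linarith)
  obtain ⟨M2, hM2, hb2⟩ := aux_bound α t₀ 4 ht₀ r hrc (by
    filter_upwards [ev2, eventually_gt_atTop t₀, eventually_ge_atTop 1] with s h1 h2 h3
    rw [← hddp s h2]
    refine h1.trans ?_
    have := Real.rpow_le_rpow_of_exponent_le h3 (by linarith : -α - 2 ≤ -α)
    linarith)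
  have absmul : ∀ u v w : ℝ, |v| ≤ 1 → |u| ≤ w → |u * v| ≤ w := by
    intro u v w h1 h2
    rw [abs_mul]
    nlinarith [abs_nonneg u, abs_nonneg v]
  set X : ℝ → ℝ := fun s => p s * Real.sin s with hX
  set Y : ℝ → ℝ := fun s => q s * Real.sin s + p s * Real.cos s with hY
  set Z : ℝ → ℝ := fun s => (r s * Real.sin s + q s * Real.cos s) +
    (q s * Real.cos s + p s * (-Real.sin s)) with hZ
  have hXc : ContinuousOn X S := hpc.mul Real.continuous_sin.continuousOn
  have hYc : ContinuousOn Y S := (hqc.mul Real.continuous_sin.continuousOn).add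
    (hpc.mul Real.continuous_cos.continuousOn)
  have hXd : ∀ t, t₀ < t → HasDerivAt X (Y t) t := fun t ht =>
    (hpd t ht).mul (Real.hasDerivAt_sin t)
  have hYd : ∀ t, t₀ < t → HasDerivAt Y (Z t) t := fun t ht =>
    ((hqd t ht).mul (Real.hasDerivAt_sin t)).add ((hpd t ht).mul (Real.hasDerivAt_cos t))
  set M : ℝ := M0 + 2 * M1 + M2 with hM
  have hMn : 0 ≤ M := by positivity
  have bX : ∀ t, t₀ ≤ t → |X t| ≤ M * t ^ (-α) := by
    intro t ht
    have h1 : 0 < t ^ (-α) := Real.rpow_pos_of_pos (by linarith) _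
    have a := absmul _ _ _ (Real.abs_sin_le_one t) (hb0 t ht)
    refine a.trans ?_
    gcongr
    linarith
  have bY : ∀ t, t₀ ≤ t → |Y t| ≤ M * t ^ (-α) := by
    intro t ht
    have h1 : 0 < t ^ (-α) := Real.rpow_pos_of_pos (by linarith) _
    have a := absmul _ _ _ (Real.abs_sin_le_one t) (hb1 t ht)
    have b := absmul _ _ _ (Real.abs_cos_le_one t) (hb0 t ht)
    have h2 : (M0 + M1) * t ^ (-α) ≤ M * t ^ (-α) := by
      gcongr
      linarith
    have := abs_add_le (q t * Real.sin t) (p t * Real.cos t)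
    simp only [hY]
    linarith
  have bZ : ∀ t, t₀ ≤ t → |Z t| ≤ M * t ^ (-α) := by
    intro t ht
    have a := absmul _ _ _ (Real.abs_sin_le_one t) (hb2 t ht)
    have b := absmul _ _ _ (Real.abs_cos_le_one t) (hb1 t ht)
    have c := absmul _ (-Real.sin t) _ (by rw [abs_neg]; exact Real.abs_sin_le_one t) (hb0 t ht)
    have h1 := abs_add_le (r t * Real.sin t + q t * Real.cos t)
      (q t * Real.cos t + p t * (-Real.sin t))
    have h2 := abs_add_le (r t * Real.sin t) (q t * Real.cos t)
    have h3 := abs_add_le (q t * Real.cos t) (p t * (-Real.sin t))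
    simp only [hZ, hM]
    linarith
  have lX := aux_lip α t₀ M hα1 ht₀ X Y hXc hXd (fun t ht => bY t ht.le)
  have lY := aux_lip α t₀ M hα1 ht₀ Y Z hYc hYd (fun t ht => bZ t ht.le)
  have hΓsub : ∀ a ∈ Γ, a = (x t₀, x' t₀) ∨ ∃ t, t₀ ≤ t ∧ a = (X t, Y t) := by
    intro a ha
    rw [hΓ] at ha
    obtain ⟨s, hs, rfl⟩ := ha
    rcases eq_or_lt_of_le hs with h | h
    · left; rw [h]
    · right
      refine ⟨s, hs, ?_⟩
      rw [hx, hx', hdp s h]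
  have hupper := aux_upper α t₀ (M / (1 - α)) M hα0 hα1 ht₀
    (div_nonneg hMn (by linarith)) hMn X Y (x t₀, x' t₀) Γ lX lY bX bY hΓsub
  have hlim : Tendsto p atTop (nhds 0) := by
    have h1 : Tendsto (fun s : ℝ => 2 * s ^ (-α)) atTop (nhds 0) := by
      simpa using (tendsto_rpow_neg_atTop hα0).const_mul 2
    refine tendsto_of_tendsto_of_tendsto_of_le_of_le' tendsto_const_nhds h1 ?_ ?_
    · filter_upwards [eventually_ge_atTop t₀] with s h using (hp_pos s h).le
    · filter_upwards [ev0] with s h using h.2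
  obtain ⟨T₁, hT₁⟩ := eventually_atTop.1 (ev0.and (ev1.and (eventually_gt_atTop t₀)))
  have hT₁0 : t₀ < T₁ := (hT₁ T₁ le_rfl).2.2
  have hlower := aux_lower α T₁ hα0 hα1 (by linarith) p Γ
    (hpc.mono (Set.Ici_subset_Ici.2 hT₁0.le))
    (fun s hs => (hpd s (hT₁ s hs).2.2).differentiableAt)
    (fun s hs => (hT₁ s hs).1.1) (fun s hs => (hT₁ s hs).2.1) hlim
    (fun s hs => by
      rw [hΓ]
      exact ⟨s, (hT₁ s hs).2.2.le, by rw [hx, hx']⟩)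
  refine ⟨?_, aux_boxdim Γ (2 / (1 + α)) _ _ (by positivity) (by positivity) hlower hupper⟩
  have hsub : Γ ⊆ insert (x t₀, x' t₀) (Metric.closedBall 0 (M * t₀ ^ (-α))) := by
    intro a ha
    rcases hΓsub a ha with h | ⟨t, ht, rfl⟩
    · exact Or.inl h
    · right
      have h3 : M * t ^ (-α) ≤ M * t₀ ^ (-α) := mul_le_mul_of_nonneg_left
        (Real.rpow_le_rpow_of_nonpos ht₀ ht (by linarith)) hMn
      rw [mem_closedBall_zero_iff, Prod.norm_def, max_le_iff]
      exact ⟨(bX t ht).trans h3, (bY t ht).trans h3⟩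
  exact (Metric.isBounded_closedBall.insert _).subset hsub
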